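/- arXiv:2012.14775 — 3 statements merged into one kernel-verified Lean document; each statement's English description precedes it below -/
import Mathlib

section
/- Let d ∈ ℕ, α ∈ (0,2) and β₁, β₂ ∈ [0, d+α). There is a constant C > 0, depending only on d, α, β₁, β₂, such that for all s, t > 0 and x, y ∈ ℝ^d: [ (1 ∧ (s^{1/α}+|x|)^{β₁}) / (s^{1/α}+|x|)^{d+α} ] · [ (1 ∧ (t^{1/α}+|y|)^{β₂}) / (t^{1/α}+|y|)^{d+α} ] ≤ C ( (1 ∧ (s^{1/α}+|x|)^{β₁}) / (s^{1/α}+|x|)^{d+α} + (1 ∧ (t^{1/α}+|y|)^{β₂}) / (t^{1/α}+|y|)^{d+α} ) · (1 ∧ ((t+s)^{1/α}+|x+y|)^{β₁∧β₂}) / ((t+s)^{1/α}+|x+y|)^{d+α}. -/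
open Real Set

noncomputable section

abbrev Ed (d : ℕ) := EuclideanSpace ℝ (Fin d)

/-- The kernel profile `u ↦ (1 ∧ u ^ β) / u ^ p`. -/
def kernelProfile (β p u : ℝ) : ℝ := min 1 (u ^ β) / u ^ p

lemma kernelProfile_nonneg (β p : ℝ) {u : ℝ} (hu : 0 < u) : 0 ≤ kernelProfile β p u := by
  unfold kernelProfile
  positivity

lemma kernelProfile_eq_min (β p : ℝ) {u : ℝ} (hu : 0 < u) :
    kernelProfile β p u = min (u ^ (-p)) (u ^ (β - p)) := by
  rw [kernelProfile, ← min_div_div_right (rpow_nonneg hu.le p), rpow_neg hu.le,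
    rpow_sub hu, one_div]

lemma kernelProfile_le_of_le {β p u v : ℝ} (hp : 0 ≤ p) (hβ : β ≤ p) (hu : 0 < u)
    (huv : u ≤ v) : kernelProfile β p v ≤ kernelProfile β p u := by
  rw [kernelProfile_eq_min β p hu, kernelProfile_eq_min β p (hu.trans_le huv)]
  exact min_le_min (rpow_le_rpow_of_nonpos hu huv (by linarith))
    (rpow_le_rpow_of_nonpos hu huv (by linarith))

lemma kernelProfile_le_of_exponent_le {β γ p u : ℝ} (hγ : 0 ≤ γ) (hγβ : γ ≤ β) (hu : 0 < u) :
    kernelProfile β p u ≤ kernelProfile γ p u := by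
  unfold kernelProfile
  gcongr ?_ / _
  rcases le_total u 1 with h | h
  · exact min_le_min le_rfl (rpow_le_rpow_of_exponent_ge hu h hγβ)
  · rw [min_eq_left (one_le_rpow h hγ)]
    exact min_le_left _ _

lemma kernelProfile_le_mul_dilate {β p u L : ℝ} (hβ : 0 ≤ β) (hL : 1 ≤ L) (hu : 0 < u) :
    kernelProfile β p u ≤ L ^ p * kernelProfile β p (L * u) := by
  have hL0 : 0 < L := by linarith
  have hLp : 0 < L ^ p := rpow_pos_of_pos hL0 p
  have hup : 0 < u ^ p := rpow_pos_of_pos hu p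
  have hmin : min 1 (u ^ β) ≤ min 1 ((L * u) ^ β) :=
    min_le_min le_rfl (rpow_le_rpow hu.le (le_mul_of_one_le_left hu.le hL) hβ)
  calc kernelProfile β p u ≤ min 1 ((L * u) ^ β) / u ^ p := by
        unfold kernelProfile
        gcongr
    _ = L ^ p * kernelProfile β p (L * u) := by
        rw [kernelProfile, mul_rpow hL0.le hu.le (z := p)]
        field_simp

lemma kernelProfile_le_mul {β γ p u v L : ℝ} (hγ : 0 ≤ γ) (hγβ : γ ≤ β) (hγp : γ ≤ p)
    (hL : 1 ≤ L) (hu : 0 < u) (hv : 0 < v) (hvu : v ≤ L * u) :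
    kernelProfile β p u ≤ L ^ p * kernelProfile γ p v :=
  calc kernelProfile β p u ≤ kernelProfile γ p u := kernelProfile_le_of_exponent_le hγ hγβ hu
    _ ≤ L ^ p * kernelProfile γ p (L * u) := kernelProfile_le_mul_dilate hγ hL hu
    _ ≤ L ^ p * kernelProfile γ p v := by
        gcongr
        exact kernelProfile_le_of_le (hγ.trans hγp) hγp hv hvu

lemma add_rpow_le_two_rpow_mul_max {s t q : ℝ} (hs : 0 ≤ s) (ht : 0 ≤ t) (hq : 0 ≤ q) :
    (t + s) ^ q ≤ 2 ^ q * max (s ^ q) (t ^ q) := by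
  rw [← (Real.monotoneOn_rpow_Ici_of_exponent_nonneg hq).map_max hs ht,
    ← mul_rpow zero_le_two (hs.trans (le_max_left s t))]
  exact rpow_le_rpow (by positivity) (by linarith [le_max_left s t, le_max_right s t]) hq

lemma add_rpow_add_norm_le {E : Type*} [SeminormedAddCommGroup E] {s t q : ℝ} (hs : 0 ≤ s)
    (ht : 0 ≤ t) (hq : 0 ≤ q) (x y : E) :
    (t + s) ^ q + ‖x + y‖ ≤ 2 * 2 ^ q * max (s ^ q + ‖x‖) (t ^ q + ‖y‖) := by
  have hK : (1 : ℝ) ≤ 2 ^ q := one_le_rpow one_le_two hq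
  have hsq := rpow_nonneg hs q
  have htq := rpow_nonneg ht q
  have hM : max (s ^ q) (t ^ q) ≤ s ^ q + t ^ q := max_le (by linarith) (by linarith)
  have ha := le_max_left (s ^ q + ‖x‖) (t ^ q + ‖y‖)
  have hb := le_max_right (s ^ q + ‖x‖) (t ^ q + ‖y‖)
  calc (t + s) ^ q + ‖x + y‖ ≤ 2 ^ q * (s ^ q + t ^ q) + 2 ^ q * (‖x‖ + ‖y‖) := by
        gcongr
        · exact (add_rpow_le_two_rpow_mul_max hs ht hq).trans (by gcongr)
        · exact (norm_add_le x y).trans (le_mul_of_one_le_left (by positivity) hK)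
    _ = 2 ^ q * ((s ^ q + ‖x‖) + (t ^ q + ‖y‖)) := by ring
    _ ≤ 2 ^ q * (2 * max (s ^ q + ‖x‖) (t ^ q + ‖y‖)) := by
        gcongr
        linarith
    _ = 2 * 2 ^ q * max (s ^ q + ‖x‖) (t ^ q + ‖y‖) := by ring

lemma kernelProfile_mul_le {β₁ β₂ p a b c L : ℝ} (hβ₁ : 0 ≤ β₁) (hβ₂ : 0 ≤ β₂) (hβ₁p : β₁ ≤ p)
    (hL : 1 ≤ L) (ha : 0 < a) (hb : 0 < b) (hc : 0 < c) (hcL : c ≤ L * max a b) :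
    kernelProfile β₁ p a * kernelProfile β₂ p b ≤
      L ^ p * (kernelProfile β₁ p a + kernelProfile β₂ p b) *
        kernelProfile (min β₁ β₂) p c := by
  have hm : 0 ≤ min β₁ β₂ := le_min hβ₁ hβ₂
  have hmp : min β₁ β₂ ≤ p := (min_le_left _ _).trans hβ₁p
  have hF := kernelProfile_nonneg β₁ p ha
  have hG := kernelProfile_nonneg β₂ p hb
  have hH : 0 ≤ L ^ p * kernelProfile (min β₁ β₂) p c :=
    mul_nonneg (by positivity) (kernelProfile_nonneg _ p hc)
  rcases le_total a b with hab | hab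
  · rw [max_eq_right hab] at hcL
    have key := kernelProfile_le_mul hm (min_le_right β₁ β₂) hmp hL hb hc hcL
    linarith [mul_le_mul_of_nonneg_left key hF, mul_nonneg hG hH]
  · rw [max_eq_left hab] at hcL
    have key := kernelProfile_le_mul hm (min_le_left β₁ β₂) hmp hL ha hc hcL
    linarith [mul_le_mul_of_nonneg_left key hG, mul_nonneg hF hH]

/-- two-point pointwise inequality for the stable-type kernels. -/
theorem statement12 (d : ℕ) (hd : 0 < d) (α β₁ β₂ : ℝ) (hα : α ∈ Set.Ioo (0 : ℝ) 2)
    (hβ₁ : β₁ ∈ Set.Ico (0 : ℝ) ((d : ℝ) + α)) (hβ₂ : β₂ ∈ Set.Ico (0 : ℝ) ((d : ℝ) + α)) :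
    ∃ C : ℝ, 0 < C ∧ ∀ (s t : ℝ), 0 < s → 0 < t → ∀ x y : Ed d,
      (min 1 ((s ^ (1/α) + ‖x‖) ^ β₁) / (s ^ (1/α) + ‖x‖) ^ ((d : ℝ) + α)) *
        (min 1 ((t ^ (1/α) + ‖y‖) ^ β₂) / (t ^ (1/α) + ‖y‖) ^ ((d : ℝ) + α))
      ≤ C * ((min 1 ((s ^ (1/α) + ‖x‖) ^ β₁) / (s ^ (1/α) + ‖x‖) ^ ((d : ℝ) + α)) +
             (min 1 ((t ^ (1/α) + ‖y‖) ^ β₂) / (t ^ (1/α) + ‖y‖) ^ ((d : ℝ) + α))) *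
          (min 1 (((t + s) ^ (1/α) + ‖x + y‖) ^ (min β₁ β₂)) /
            ((t + s) ^ (1/α) + ‖x + y‖) ^ ((d : ℝ) + α)) := by
  have hq : 0 ≤ 1 / α := one_div_nonneg.mpr hα.1.le
  have hL : (1 : ℝ) ≤ 2 * 2 ^ (1 / α) := by linarith [one_le_rpow one_le_two hq]
  refine ⟨(2 * 2 ^ (1 / α)) ^ ((d : ℝ) + α), by positivity, fun s t hs ht x y => ?_⟩
  exact kernelProfile_mul_le hβ₁.1 hβ₂.1 hβ₁.2.le hL (by positivity) (by positivity)
    (by positivity) (add_rpow_add_norm_le hs.le ht.le hq x y)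
end
end

section
/- Let d ∈ ℕ, α ∈ (0,2), η > 0, β ∈ [0, η), γ ∈ ℝ and T > 0. There is a constant C > 0, depending only on d, α, η, β, γ, T, such that for all t ∈ (0, T]: ∫_{ℝ^d} (1 ∧ (t^{1/α} + |y|))^β · t^{γ/α} / (t^{1/α} + |y|)^{d+η} dy ≤ C t^{(β+γ−η)/α}. -/
open MeasureTheory Real Set

noncomputable section

/-- Scaling form of the Japanese bracket `(r + ‖y‖) ^ (-p)`. -/
lemma add_norm_rpow_neg_eq {E : Type*} [NormedAddCommGroup E] [NormedSpace ℝ E]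
    {r : ℝ} (hr : 0 < r) (p : ℝ) (y : E) :
    (r + ‖y‖) ^ (-p) = r ^ (-p) * (1 + ‖r⁻¹ • y‖) ^ (-p) := by
  rw [← mul_rpow hr.le (by positivity), norm_smul, norm_inv, norm_of_nonneg hr.le, mul_add,
    mul_one, mul_inv_cancel_left₀ hr.ne']

section Haar

variable {E : Type*} [NormedAddCommGroup E] [NormedSpace ℝ E] [FiniteDimensional ℝ E]
  [MeasurableSpace E] [BorelSpace E] (μ : Measure E) [μ.IsAddHaarMeasure]

lemma integrable_add_norm_rpow_neg {r p : ℝ} (hr : 0 < r) (hp : (Module.finrank ℝ E : ℝ) < p) :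
    Integrable (fun y : E => (r + ‖y‖) ^ (-p)) μ := by
  simp_rw [add_norm_rpow_neg_eq hr p]
  exact ((integrable_comp_smul_iff μ (fun y : E => (1 + ‖y‖) ^ (-p))
    (inv_ne_zero hr.ne')).2 (integrable_one_add_norm hp)).const_mul _

lemma integral_add_norm_rpow_neg {r : ℝ} (hr : 0 < r) (p : ℝ) :
    ∫ y : E, (r + ‖y‖) ^ (-p) ∂μ =
      r ^ ((Module.finrank ℝ E : ℝ) - p) * ∫ y : E, (1 + ‖y‖) ^ (-p) ∂μ := by
  simp_rw [add_norm_rpow_neg_eq hr p]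
  rw [integral_const_mul, Measure.integral_comp_inv_smul_of_nonneg μ
    (fun y : E => (1 + ‖y‖) ^ (-p)) hr.le, smul_eq_mul, ← mul_assoc, ← rpow_natCast,
    ← rpow_add hr, neg_add_eq_sub]

end Haar

/-- integral bound for the kernel ρ^{(η)}_{β,γ}. -/
theorem statement13 (d : ℕ) (hd : 0 < d) (α η β γ T : ℝ) (hα : α ∈ Set.Ioo (0 : ℝ) 2)
    (hη : 0 < η) (hβ : β ∈ Set.Ico (0 : ℝ) η) (hT : 0 < T) :
    ∃ C : ℝ, 0 < C ∧ ∀ t : ℝ, t ∈ Set.Ioc 0 T →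
      (∫ y : Ed d, (min 1 (t ^ (1/α) + ‖y‖)) ^ β * t ^ (γ/α)
          / (t ^ (1/α) + ‖y‖) ^ ((d : ℝ) + η))
        ≤ C * t ^ ((β + γ - η)/α) := by
  have hβη : (Module.finrank ℝ (Ed d) : ℝ) < d + η - β := by
    rw [finrank_euclideanSpace_fin]
    linarith [hβ.2]
  have hI : 0 ≤ ∫ y : Ed d, (1 + ‖y‖) ^ (-(d + η - β)) :=
    integral_nonneg fun y => by positivity
  refine ⟨(∫ y : Ed d, (1 + ‖y‖) ^ (-(d + η - β))) + 1, by positivity, fun t ht => ?_⟩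
  have ht0 : 0 < t := ht.1
  have hr : 0 < t ^ (1 / α) := rpow_pos_of_pos ht0 _
  calc
    _ ≤ ∫ y : Ed d, t ^ (γ / α) * (t ^ (1 / α) + ‖y‖) ^ (-(d + η - β)) := by
      refine integral_mono_of_nonneg (.of_forall fun y => ?_)
        ((integrable_add_norm_rpow_neg volume hr hβη).const_mul _) (.of_forall fun y => ?_)
      · dsimp only [Pi.zero_apply]
        positivity
      · have hs : 0 < t ^ (1 / α) + ‖y‖ := by positivity
        dsimp only
        rw [neg_sub, rpow_sub hs, mul_comm (_ ^ β), mul_div_assoc]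
        gcongr
        · exact hβ.1
        · exact min_le_right _ _
    _ = (∫ y : Ed d, (1 + ‖y‖) ^ (-(d + η - β))) * t ^ ((β + γ - η) / α) := by
      rw [integral_const_mul, integral_add_norm_rpow_neg volume hr, finrank_euclideanSpace_fin,
        ← rpow_mul ht0.le, ← mul_assoc, ← rpow_add ht0, mul_comm]
      congr 2
      ring
    _ ≤ _ := by
      gcongr
      exact le_add_of_nonneg_right zero_le_one
end
end

section
/- Let d ∈ ℕ and α ∈ (0,2). There is a constant C > 0, depending only on d and α, such that for all x ∈ ℝ^d: ∫_{ℝ^d} (1 + |x + z|)^{−d−α} · (|z|² ∧ 1) / |z|^{d+α} dz ≤ C (1 + |x|)^{−d−α}. -/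
open MeasureTheory Real Set

noncomputable section

/-- The truncated kernel `(|z|² ∧ 1) / |z|^(d+α)` is integrable for `0 < α < 2`. -/
lemma integrable_min_sq_one_div_norm_rpow {d : ℕ} (hd : 0 < d) {α : ℝ}
    (hα : α ∈ Set.Ioo (0 : ℝ) 2) :
    Integrable (fun z : Ed d => min (‖z‖ ^ 2) 1 / ‖z‖ ^ ((d : ℝ) + α)) := by
  obtain ⟨h0, h2⟩ := hα
  have : Nontrivial (Ed d) := by
    have : Nonempty (Fin d) := ⟨⟨0, hd⟩⟩
    infer_instance
  refine (integrable_fun_norm_addHaar (volume : Measure (Ed d))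
    (f := fun y : ℝ => min (y ^ 2) 1 / y ^ ((d : ℝ) + α))).2 ?_
  have hpow : ∀ y : ℝ, 0 < y → y ^ (d - 1) = y ^ ((d : ℝ) - 1) := fun y hy => by
    rw [← Real.rpow_natCast, Nat.cast_sub hd, Nat.cast_one]
  rw [finrank_euclideanSpace, Fintype.card_fin, ← Ioc_union_Ioi_eq_Ioi zero_le_one]
  refine IntegrableOn.union ?_ ?_
  · have h : IntegrableOn (fun y : ℝ => y ^ (1 - α)) (Ioc 0 1) :=
      (intervalIntegrable_iff_integrableOn_Ioc_of_le zero_le_one).1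
        (intervalIntegral.intervalIntegrable_rpow' (by linarith))
    refine h.congr_fun (fun y hy => ?_) measurableSet_Ioc
    have hmin : min (y ^ 2) 1 = y ^ (2 : ℝ) := by
      rw [Real.rpow_two]
      exact min_eq_left (pow_le_one₀ hy.1.le hy.2)
    simp only [smul_eq_mul]
    rw [hpow y hy.1, hmin, ← Real.rpow_sub hy.1, ← Real.rpow_add hy.1]
    congr 1
    ring
  · refine (integrableOn_Ioi_rpow_of_lt (a := -1 - α) (by linarith) zero_lt_one).congr_fun
      (fun y hy => ?_) measurableSet_Ioi
    have hy1 : (1 : ℝ) < y := hy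
    have hy0 : 0 < y := by linarith
    simp only [smul_eq_mul]
    rw [hpow y hy0, min_eq_right (one_le_pow₀ hy1.le), one_div, ← Real.rpow_neg hy0.le,
      ← Real.rpow_add hy0]
    congr 1
    ring

lemma rpow_neg_le_two_rpow_mul {p a b : ℝ} (hp : 0 ≤ p) (ha : 0 < a) (hab : a ≤ 2 * b) :
    b ^ (-p) ≤ 2 ^ p * a ^ (-p) := by
  calc b ^ (-p) ≤ (a / 2) ^ (-p) :=
        Real.rpow_le_rpow_of_nonpos (by positivity) (by linarith) (by linarith)
    _ = 2 ^ p * a ^ (-p) := by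
        rw [Real.div_rpow ha.le zero_le_two, Real.rpow_neg zero_le_two, div_inv_eq_mul, mul_comm]

lemma one_add_norm_rpow_mul_kernel_le {E : Type*} [NormedAddCommGroup E] {p : ℝ} (hp : 0 ≤ p)
    (x z : E) :
    (1 + ‖x + z‖) ^ (-p) * (min (‖z‖ ^ 2) 1 / ‖z‖ ^ p) ≤
      2 ^ p * (1 + ‖x‖) ^ (-p) * (min (‖z‖ ^ 2) 1 / ‖z‖ ^ p + (1 + ‖x + z‖) ^ (-p)) := by
  have hx : 0 < 1 + ‖x‖ := by positivity
  have hk : 0 ≤ min (‖z‖ ^ 2) 1 / ‖z‖ ^ p := by positivity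
  have hr : 0 ≤ (1 + ‖x + z‖) ^ (-p) := by positivity
  have hc : 0 ≤ 2 ^ p * (1 + ‖x‖) ^ (-p) := by positivity
  have htri : ‖x‖ ≤ ‖x + z‖ + ‖z‖ := by simpa using norm_sub_le (x + z) z
  rw [mul_add]
  rcases le_total (1 + ‖x‖) (2 * (1 + ‖x + z‖)) with h | h
  · have := mul_le_mul_of_nonneg_right (rpow_neg_le_two_rpow_mul hp hx h) hk
    have := mul_nonneg hc hr
    linarith
  · have hz : min (‖z‖ ^ 2) 1 / ‖z‖ ^ p ≤ ‖z‖ ^ (-p) := by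
      rw [Real.rpow_neg (norm_nonneg z), ← one_div]
      gcongr
      exact min_le_right _ _
    have := mul_le_mul_of_nonneg_right
      (hz.trans (rpow_neg_le_two_rpow_mul (b := ‖z‖) hp hx (by linarith))) hr
    have := mul_nonneg hc hk
    linarith

/-- ∫ (1+|x+z|)^{−d−α} (|z|²∧1) |z|^{−d−α} dz ≤ C (1+|x|)^{−d−α}. -/
theorem statement18 (d : ℕ) (hd : 0 < d) (α : ℝ) (hα : α ∈ Set.Ioo (0 : ℝ) 2) :
    ∃ C : ℝ, 0 < C ∧ ∀ x : Ed d,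
      (∫ z : Ed d, (1 + ‖x + z‖) ^ (-((d : ℝ) + α)) * min (‖z‖ ^ 2) 1 / ‖z‖ ^ ((d : ℝ) + α))
        ≤ C * (1 + ‖x‖) ^ (-((d : ℝ) + α)) := by
  set p : ℝ := (d : ℝ) + α with hp_def
  have hp : 0 ≤ p := by have := hα.1; positivity
  have hk : Integrable (fun z : Ed d => min (‖z‖ ^ 2) 1 / ‖z‖ ^ p) :=
    integrable_min_sq_one_div_norm_rpow hd hα
  have hr : Integrable (fun z : Ed d => (1 + ‖z‖) ^ (-p)) :=
    integrable_one_add_norm (by rw [finrank_euclideanSpace, Fintype.card_fin]; linarith [hα.1])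
  set A := ∫ z : Ed d, min (‖z‖ ^ 2) 1 / ‖z‖ ^ p
  set B := ∫ z : Ed d, (1 + ‖z‖) ^ (-p)
  have hA : 0 ≤ A := integral_nonneg fun z => by positivity
  have hB : 0 ≤ B := integral_nonneg fun z => by positivity
  refine ⟨2 ^ p * (A + B + 1), by positivity, fun x => ?_⟩
  have hrx : Integrable (fun z : Ed d => (1 + ‖x + z‖) ^ (-p)) := hr.comp_add_left x
  have hB_eq : ∫ z : Ed d, (1 + ‖x + z‖) ^ (-p) = B :=
    integral_add_left_eq_self (fun z : Ed d => (1 + ‖z‖) ^ (-p)) x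
  calc _ ≤ ∫ z : Ed d, 2 ^ p * (1 + ‖x‖) ^ (-p) *
          (min (‖z‖ ^ 2) 1 / ‖z‖ ^ p + (1 + ‖x + z‖) ^ (-p)) := by
        refine integral_mono_of_nonneg (ae_of_all _ fun z => ?_) ((hk.add hrx).const_mul _)
          (ae_of_all _ fun z => ?_)
        · simp only [Pi.zero_apply]
          positivity
        · simp only [mul_div_assoc]
          exact one_add_norm_rpow_mul_kernel_le hp x z
    _ = 2 ^ p * (1 + ‖x‖) ^ (-p) * (A + B) := by
        rw [integral_const_mul, integral_add hk hrx, hB_eq]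
    _ ≤ 2 ^ p * (A + B + 1) * (1 + ‖x‖) ^ (-p) := by
        have : 0 ≤ 2 ^ p * (1 + ‖x‖) ^ (-p) := by positivity
        nlinarith
end
end
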